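/- arXiv:2508.09492 — 4 statements merged into one kernel-verified Lean document; each statement's English description precedes it below -/
import Mathlib

section
/- For all nodes i,j ∈ N and every subset A ⊆ N, the following identities hold in ℤ[[x]]: (i) m_{ij} = m_{ij}^{¬A} + m_{ij}^{A}; (ii) m_{ij}^{A} = Σ_{l∈A} (m_{il}^{¬A} − 1_{l=i})·(m_{lj} − 1_{l=j}), where 1_{l=i} denotes the constant power series 1 if l=i and 0 otherwise. -/
/-- The number of length-`t` walks from `i` to `j` in the graph with 0-1 adjacency
matrix `G`, encoded as functions `Fin (t+1) → Fin n`. -/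
def walkCount {n : ℕ} (G : Matrix (Fin n) (Fin n) ℤ) (i j : Fin n) (t : ℕ) : ℕ :=
  (Finset.univ.filter fun w : Fin (t + 1) → Fin n =>
    w 0 = i ∧ w (Fin.last t) = j ∧
      ∀ k : Fin t, G (w k.castSucc) (w k.succ) = 1).card

/-- The number of length-`t` walks from `i` to `j` none of whose intermediate nodes
lies in `A`. -/
def walkCountAvoid {n : ℕ} (G : Matrix (Fin n) (Fin n) ℤ) (A : Finset (Fin n))
    (i j : Fin n) (t : ℕ) : ℕ :=
  (Finset.univ.filter fun w : Fin (t + 1) → Fin n =>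
    w 0 = i ∧ w (Fin.last t) = j ∧
      (∀ k : Fin t, G (w k.castSucc) (w k.succ) = 1) ∧
      ∀ k : Fin (t + 1), k ≠ 0 → k ≠ Fin.last t → w k ∉ A).card

/-- The number of length-`t` walks from `i` to `j` some of whose intermediate nodes
lies in `A`. -/
def walkCountPass {n : ℕ} (G : Matrix (Fin n) (Fin n) ℤ) (A : Finset (Fin n))
    (i j : Fin n) (t : ℕ) : ℕ :=
  (Finset.univ.filter fun w : Fin (t + 1) → Fin n =>
    w 0 = i ∧ w (Fin.last t) = j ∧
      (∀ k : Fin t, G (w k.castSucc) (w k.succ) = 1) ∧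
      ∃ k : Fin (t + 1), k ≠ 0 ∧ k ≠ Fin.last t ∧ w k ∈ A).card

/-- `m_{ij}` : walk generating function. -/
noncomputable def mSer {n : ℕ} (G : Matrix (Fin n) (Fin n) ℤ) (i j : Fin n) :
    PowerSeries ℤ :=
  PowerSeries.mk fun t => (walkCount G i j t : ℤ)

/-- `m_{ij}^{¬A}`. -/
noncomputable def mAvoid {n : ℕ} (G : Matrix (Fin n) (Fin n) ℤ) (A : Finset (Fin n))
    (i j : Fin n) : PowerSeries ℤ :=
  PowerSeries.mk fun t => (walkCountAvoid G A i j t : ℤ)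

/-- `m_{ij}^{A}`. -/
noncomputable def mPass {n : ℕ} (G : Matrix (Fin n) (Fin n) ℤ) (A : Finset (Fin n))
    (i j : Fin n) : PowerSeries ℤ :=
  PowerSeries.mk fun t => (walkCountPass G A i j t : ℤ)

open Finset in
/-- Splitting off the first node of a nonempty walk and sorting the tails by their first node. -/
lemma card_filter_tail_eq_sum {α : Type*} [Fintype α] [DecidableEq α] {t : ℕ} (i : α)
    (q : (Fin (t + 2) → α) → Prop) (p : α → (Fin (t + 1) → α) → Prop)
    [DecidablePred q] [∀ k, DecidablePred (p k)]
    (h : ∀ v : Fin (t + 1) → α, q (Fin.cons i v) ↔ p (v 0) v)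
    (h' : ∀ w, q w → w 0 = i) :
    (univ.filter q).card = ∑ k, (univ.filter fun v => v 0 = k ∧ p k v).card := by
  have hcard : (univ.filter q).card =
      (univ.filter fun v : Fin (t + 1) → α => p (v 0) v).card := by
    symm
    refine card_bij' (fun v _ => Fin.cons i v) (fun w _ => Fin.tail w) ?_ ?_ ?_ ?_
    · intro v hv
      simpa [h] using hv
    · intro w hw
      have hq : q w := by simpa using hw
      rw [mem_filter_univ, ← h, ← h' w hq, Fin.cons_self_tail]
      exact hq
    · intro v _
      exact Fin.tail_cons _ _
    · intro w hw
      have hq : q w := by simpa using hw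
      rw [← h' w hq, Fin.cons_self_tail]
  rw [hcard, card_eq_sum_card_fiberwise (f := fun v => v 0) (t := univ) (by simp)]
  refine sum_congr rfl fun k _ => congrArg card ?_
  ext v
  simp only [mem_filter, mem_univ, true_and]
  constructor
  · rintro ⟨hp, rfl⟩
    exact ⟨rfl, hp⟩
  · rintro ⟨rfl, hp⟩
    exact ⟨hp, rfl⟩

section Recurrences

variable {n : ℕ} (G : Matrix (Fin n) (Fin n) ℤ) (A : Finset (Fin n))

lemma walkCount_zero (i j : Fin n) : walkCount G i j 0 = if i = j then 1 else 0 := by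
  unfold walkCount
  split_ifs with hij
  · subst hij
    rw [Finset.card_eq_one]
    refine ⟨fun _ => i, ?_⟩
    ext w
    simp [funext_iff, Fin.forall_fin_one]
  · rw [Finset.card_eq_zero, Finset.filter_eq_empty_iff]
    rintro w - ⟨h0, h1, -⟩
    exact hij (h0.symm.trans h1)

lemma walkCount_succ (i j : Fin n) (t : ℕ) :
    walkCount G i j (t + 1) = ∑ k, if G i k = 1 then walkCount G k j t else 0 := by
  unfold walkCount
  rw [card_filter_tail_eq_sum i _
    (fun k v => G i k = 1 ∧ v (Fin.last t) = j ∧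
      ∀ l : Fin t, G (v l.castSucc) (v l.succ) = 1) ?_ fun w hw => hw.1]
  · refine Finset.sum_congr rfl fun k _ => ?_
    split_ifs with hk <;> simp [hk]
  · intro v
    rw [Fin.forall_fin_succ, ← Fin.succ_last]
    simp only [Fin.cons_zero, Fin.cons_succ, Fin.castSucc_zero, ← Fin.succ_castSucc]
    tauto

lemma walkCountAvoid_eq_walkCount {t : ℕ} (ht : t ≤ 1) (i j : Fin n) :
    walkCountAvoid G A i j t = walkCount G i j t := by
  unfold walkCountAvoid walkCount
  congr 1
  ext w
  simp only [Finset.mem_filter, Finset.mem_univ, true_and]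
  have h : ∀ k : Fin (t + 1), k ≠ 0 → k ≠ Fin.last t → w k ∉ A := by
    intro k h0 h1
    simp only [ne_eq, Fin.ext_iff, Fin.val_zero, Fin.val_last] at h0 h1
    omega
  tauto

lemma walkCountAvoid_succ_succ (i j : Fin n) (t : ℕ) :
    walkCountAvoid G A i j (t + 2) =
      ∑ k, if G i k = 1 ∧ k ∉ A then walkCountAvoid G A k j (t + 1) else 0 := by
  unfold walkCountAvoid
  rw [card_filter_tail_eq_sum i _
    (fun k v => (G i k = 1 ∧ k ∉ A) ∧ v (Fin.last (t + 1)) = j ∧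
      (∀ l : Fin (t + 1), G (v l.castSucc) (v l.succ) = 1) ∧
      ∀ l : Fin (t + 2), l ≠ 0 → l ≠ Fin.last (t + 1) → v l ∉ A) ?_ fun w hw => hw.1]
  · refine Finset.sum_congr rfl fun k _ => ?_
    split_ifs with hk <;> simp [hk]
  · intro v
    have hv : (∀ l : Fin (t + 2), l ≠ Fin.last (t + 1) → v l ∉ A) ↔
        v 0 ∉ A ∧ ∀ l : Fin (t + 2), l ≠ 0 → l ≠ Fin.last (t + 1) → v l ∉ A := by
      refine ⟨fun h => ⟨h 0 (Fin.last_pos.ne), fun l _ => h l⟩, fun h l hl => ?_⟩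
      by_cases h0 : l = 0
      · exact h0 ▸ h.1
      · exact h.2 l h0 hl
    rw [Fin.forall_fin_succ, Fin.forall_fin_succ (n := t + 2), ← Fin.succ_last]
    simp only [Fin.cons_zero, Fin.cons_succ, Fin.castSucc_zero, ← Fin.succ_castSucc,
      ne_eq, not_true_eq_false, false_imp_iff, true_and, Fin.succ_ne_zero, not_false_eq_true,
      true_imp_iff, Fin.succ_inj] at hv ⊢
    rw [hv]
    tauto

lemma walkCount_eq_avoid_add_pass (i j : Fin n) (t : ℕ) :
    walkCount G i j t = walkCountAvoid G A i j t + walkCountPass G A i j t := by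
  unfold walkCount walkCountAvoid walkCountPass
  rw [← Finset.card_filter_add_card_filter_not
    (fun w : Fin (t + 1) → Fin n => ∀ k, k ≠ 0 → k ≠ Fin.last t → w k ∉ A),
    Finset.filter_filter, Finset.filter_filter]
  congr 2 <;> ext w <;> simp [and_assoc]

lemma mSer_eq_avoid_add_pass (i j : Fin n) :
    mSer G i j = mAvoid G A i j + mPass G A i j := by
  ext t
  simp [mSer, mAvoid, mPass, walkCount_eq_avoid_add_pass G A i j t]

end Recurrences

open PowerSeries

/-- If `Y = X • H * Y` then `Y` is divisible by every power of `X`, so it vanishes. -/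
lemma PowerSeries.matrix_eq_zero_of_eq_X_smul_mul {R ι : Type*} [CommRing R] [Fintype ι]
    (H Y : Matrix ι ι R⟦X⟧) (h : Y = (X : R⟦X⟧) • (H * Y)) : Y = 0 := by
  have hdvd : ∀ t : ℕ, ∀ i j, (X : R⟦X⟧) ^ t ∣ Y i j := by
    intro t
    induction t with
    | zero => simp
    | succ t ih =>
      intro i j
      rw [h, Matrix.smul_apply, smul_eq_mul, pow_succ', Matrix.mul_apply]
      exact mul_dvd_mul_left _ (Finset.dvd_sum fun k _ => (ih k j).mul_left _)
  ext i j t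
  exact X_pow_dvd_iff.1 (hdvd (t + 1) i j) t t.lt_succ_self

section Matrices

variable {n : ℕ} (G : Matrix (Fin n) (Fin n) ℤ) (A : Finset (Fin n))

/-- Generating functions of the walks of positive length. -/
noncomputable def serMatrix : Matrix (Fin n) (Fin n) ℤ⟦X⟧ :=
  Matrix.of fun i j => mSer G i j - if i = j then 1 else 0

/-- Generating functions of the walks of positive length avoiding `A`. -/
noncomputable def avoidMatrix : Matrix (Fin n) (Fin n) ℤ⟦X⟧ :=
  Matrix.of fun i j => mAvoid G A i j - if i = j then 1 else 0

/-- The diagonal projection onto the coordinates in `A`. -/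
noncomputable def projMatrix : Matrix (Fin n) (Fin n) ℤ⟦X⟧ :=
  Matrix.diagonal fun l => if l ∈ A then 1 else 0

lemma coeff_ite_one {R : Type*} [Semiring R] (p : Prop) [Decidable p] (t : ℕ) :
    coeff t (if p then (1 : R⟦X⟧) else 0) = if p ∧ t = 0 then 1 else 0 := by
  by_cases hp : p <;> simp [hp, coeff_one]

lemma serMatrix_eq (hG : ∀ i j, G i j = 0 ∨ G i j = 1) :
    serMatrix G = (X : ℤ⟦X⟧) • (G.map C * (1 + serMatrix G)) := by
  have h1 : 1 + serMatrix G = Matrix.of fun i j => mSer G i j := by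
    ext1 i j
    simp [serMatrix, Matrix.one_apply]
  rw [h1]
  ext i j t
  rw [Matrix.smul_apply, smul_eq_mul, Matrix.mul_apply]
  cases t with
  | zero =>
    rw [coeff_zero_X_mul]
    simp only [serMatrix, Matrix.of_apply, map_sub, coeff_ite_one, mSer, coeff_mk, walkCount_zero]
    simp
  | succ t =>
    rw [coeff_succ_X_mul]
    simp only [serMatrix, Matrix.of_apply, map_sub, coeff_ite_one, mSer, coeff_mk, walkCount_succ,
      map_sum, Matrix.map_apply, coeff_C_mul]
    push_cast
    simp only [and_false, if_false, sub_zero]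
    refine Finset.sum_congr rfl fun k _ => ?_
    rcases hG i k with h | h <;> simp [h]

lemma avoidMatrix_eq (hG : ∀ i j, G i j = 0 ∨ G i j = 1) :
    avoidMatrix G A =
      (X : ℤ⟦X⟧) • (G.map C * (1 + (1 - projMatrix A) * avoidMatrix G A)) := by
  have h1 : (1 - projMatrix A) = Matrix.diagonal fun l => if l ∈ A then 0 else (1 : ℤ⟦X⟧) := by
    rw [projMatrix, ← Matrix.diagonal_one, Matrix.diagonal_sub]
    congr 1
    ext1 l
    split_ifs <;> simp
  rw [h1]
  ext i j t
  rw [Matrix.smul_apply, smul_eq_mul, Matrix.mul_apply]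
  simp only [Matrix.add_apply, Matrix.diagonal_mul, Matrix.one_apply, avoidMatrix, Matrix.of_apply]
  rcases t with - | - | t
  · rw [coeff_zero_X_mul]
    simp only [map_sub, coeff_ite_one, mAvoid, coeff_mk,
      walkCountAvoid_eq_walkCount G A zero_le_one, walkCount_zero]
    simp
  · rw [coeff_succ_X_mul]
    simp only [map_sub, coeff_ite_one, mAvoid, coeff_mk, map_sum, Matrix.map_apply, coeff_C_mul,
      map_add, ite_mul, zero_mul, one_mul, apply_ite (coeff (R := ℤ) 0), map_zero, zero_add,
      walkCountAvoid_eq_walkCount G A le_rfl, walkCountAvoid_eq_walkCount G A zero_le_one,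
      walkCount_succ G i j 0, walkCount_zero]
    push_cast
    simp only [and_false, if_false, sub_zero]
    rw [Finset.sum_eq_single j (fun k _ hk => by simp [hk]) (by simp)]
    rcases hG i j with h | h <;> simp [h]
  · rw [coeff_succ_X_mul]
    simp only [map_sub, coeff_ite_one, mAvoid, coeff_mk, map_sum, Matrix.map_apply, coeff_C_mul,
      map_add, ite_mul, zero_mul, one_mul, apply_ite (coeff (R := ℤ) (t + 1)), map_zero,
      walkCountAvoid_succ_succ G A i j t]
    push_cast
    simp only [and_false, if_false, sub_zero]
    refine Finset.sum_congr rfl fun k _ => ?_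
    rcases hG i k with h | h <;> by_cases hk : k ∈ A <;> simp [h, hk]

lemma serMatrix_sub_avoidMatrix (hG : ∀ i j, G i j = 0 ∨ G i j = 1) :
    serMatrix G - avoidMatrix G A = avoidMatrix G A * projMatrix A * serMatrix G := by
  have hM := serMatrix_eq G hG
  have hB := avoidMatrix_eq G A hG
  rw [← Matrix.smul_mul] at hM hB
  rw [← sub_eq_zero]
  apply PowerSeries.matrix_eq_zero_of_eq_X_smul_mul (G.map C * (1 - projMatrix A))
  rw [← Matrix.smul_mul, ← Matrix.smul_mul]
  generalize (X : ℤ⟦X⟧) • G.map C = K at *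
  generalize serMatrix G = M at *
  generalize avoidMatrix G A = B at *
  generalize projMatrix A = E at *
  rw [← sub_eq_zero] at hM hB ⊢
  calc _ = (M - K * (1 + M)) - (B - K * (1 + (1 - E) * B))
        - (B - K * (1 + (1 - E) * B)) * E * M := by noncomm_ring
    _ = 0 := by rw [hM, hB]; simp

end Matrices

theorem stmt2 {n : ℕ} (hn : 0 < n) (G : Matrix (Fin n) (Fin n) ℤ)
    (hG : ∀ i j, G i j = 0 ∨ G i j = 1) (hdiag : ∀ i, G i i = 0)
    (A : Finset (Fin n)) (i j : Fin n) :
    mSer G i j = mAvoid G A i j + mPass G A i j ∧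
    mPass G A i j = ∑ l ∈ A,
      (mAvoid G A i l - if l = i then 1 else 0) * (mSer G l j - if l = j then 1 else 0) := by
  refine ⟨mSer_eq_avoid_add_pass G A i j, ?_⟩
  have h := congrFun (congrFun (serMatrix_sub_avoidMatrix G A hG) i) j
  rw [Matrix.mul_apply] at h
  simp only [projMatrix, Matrix.mul_diagonal, Matrix.sub_apply, serMatrix, avoidMatrix,
    Matrix.of_apply, sub_sub_sub_cancel_right, mul_ite, mul_one, mul_zero, ite_mul, zero_mul,
    Finset.sum_ite_mem, Finset.univ_inter] at h
  rw [mSer_eq_avoid_add_pass G A i j, add_sub_cancel_left] at h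
  simpa only [eq_comm (a := i)] using h
end

section
/- For all nodes i,j ∈ N and every set L of links of G, the following identities hold in ℤ[[x]]: (i) m_{ij} = m_{ij}^{¬L} + m_{ij}^{L}; (ii) m_{ij}^{L} = Σ_{(l,k)∈L} m_{il}^{¬L} · m_{kj} · x. -/
/-- The number of length-`t` walks from `i` to `j` none of whose steps lies in `L`. -/
def walkCountAvoidL {n : ℕ} (G : Matrix (Fin n) (Fin n) ℤ) (L : Finset (Fin n × Fin n))
    (i j : Fin n) (t : ℕ) : ℕ :=
  (Finset.univ.filter fun w : Fin (t + 1) → Fin n =>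
    w 0 = i ∧ w (Fin.last t) = j ∧
      (∀ k : Fin t, G (w k.castSucc) (w k.succ) = 1) ∧
      ∀ k : Fin t, (w k.castSucc, w k.succ) ∉ L).card

/-- The number of length-`t` walks from `i` to `j` some of whose steps lies in `L`. -/
def walkCountUseL {n : ℕ} (G : Matrix (Fin n) (Fin n) ℤ) (L : Finset (Fin n × Fin n))
    (i j : Fin n) (t : ℕ) : ℕ :=
  (Finset.univ.filter fun w : Fin (t + 1) → Fin n =>
    w 0 = i ∧ w (Fin.last t) = j ∧
      (∀ k : Fin t, G (w k.castSucc) (w k.succ) = 1) ∧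
      ∃ k : Fin t, (w k.castSucc, w k.succ) ∈ L).card

/-- `m_{ij}^{¬L}`. -/
noncomputable def mAvoidL {n : ℕ} (G : Matrix (Fin n) (Fin n) ℤ)
    (L : Finset (Fin n × Fin n)) (i j : Fin n) : PowerSeries ℤ :=
  PowerSeries.mk fun t => (walkCountAvoidL G L i j t : ℤ)

/-- `m_{ij}^{L}`. -/
noncomputable def mUseL {n : ℕ} (G : Matrix (Fin n) (Fin n) ℤ)
    (L : Finset (Fin n × Fin n)) (i j : Fin n) : PowerSeries ℤ :=
  PowerSeries.mk fun t => (walkCountUseL G L i j t : ℤ)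

open PowerSeries in
/-- The matrix with entry `X` at each related pair and `0` elsewhere. -/
noncomputable def relMatrix {n : ℕ} (R : Fin n → Fin n → Prop) [DecidableRel R] :
    Matrix (Fin n) (Fin n) (PowerSeries ℤ) :=
  Matrix.of fun i j => if R i j then X else 0

/-- The number of length-`t` walks from `i` to `j` all of whose steps are related by `R`. -/
def relWalkCount {n : ℕ} (R : Fin n → Fin n → Prop) [DecidableRel R]
    (i j : Fin n) (t : ℕ) : ℕ :=
  (Finset.univ.filter fun w : Fin (t + 1) → Fin n =>
    w 0 = i ∧ w (Fin.last t) = j ∧ ∀ k : Fin t, R (w k.castSucc) (w k.succ)).card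

/-- The matrix of generating functions of `relWalkCount`. -/
noncomputable def relWalkSeries {n : ℕ} (R : Fin n → Fin n → Prop) [DecidableRel R] :
    Matrix (Fin n) (Fin n) (PowerSeries ℤ) :=
  Matrix.of fun i j => PowerSeries.mk fun t => (relWalkCount R i j t : ℤ)

section

variable {n : ℕ} (R : Fin n → Fin n → Prop) [DecidableRel R]

lemma relWalkCount_zero (i j : Fin n) :
    relWalkCount R i j 0 = if i = j then 1 else 0 := by
  unfold relWalkCount
  split_ifs with h
  · subst h
    rw [Finset.card_eq_one]
    refine ⟨fun _ => i, ?_⟩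
    ext w
    simp [funext_iff, Fin.forall_fin_one]
  · rw [Finset.card_eq_zero, Finset.filter_eq_empty_iff]
    rintro w - ⟨h0, h1, -⟩
    exact h (h0.symm.trans h1)

/-- Splitting off the first step of a walk. -/
lemma relWalkCount_succ (i j : Fin n) (t : ℕ) :
    relWalkCount R i j (t + 1) = ∑ k, if R i k then relWalkCount R k j t else 0 := by
  rw [← Finset.sum_filter]
  unfold relWalkCount
  rw [← Finset.card_sigma]
  refine Finset.card_bij' (fun w _ => ⟨w 1, Fin.tail w⟩) (fun p _ => Fin.cons i p.2) ?_ ?_ ?_ ?_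
  · intro w hw
    simp only [Finset.mem_filter, Finset.mem_univ, true_and, Fin.forall_fin_succ (n := t)] at hw
    obtain ⟨rfl, rfl, h0, h⟩ := hw
    simp only [Finset.mem_sigma, Finset.mem_filter, Finset.mem_univ, true_and]
    exact ⟨h0, rfl, rfl, h⟩
  · rintro ⟨k, w⟩ hw
    simp only [Finset.mem_sigma, Finset.mem_filter, Finset.mem_univ, true_and] at hw
    obtain ⟨h0, rfl, rfl, h⟩ := hw
    simp only [Finset.mem_filter, Finset.mem_univ, true_and, Fin.forall_fin_succ (n := t)]
    exact ⟨rfl, rfl, h0, h⟩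
  · intro w hw
    simp only [Finset.mem_filter, Finset.mem_univ, true_and] at hw
    obtain ⟨rfl, -⟩ := hw
    exact Fin.cons_self_tail w
  · rintro ⟨k, w⟩ hw
    simp only [Finset.mem_sigma, Finset.mem_filter, Finset.mem_univ, true_and] at hw
    obtain ⟨-, rfl, -⟩ := hw
    rfl

lemma relWalkSeries_eq : relWalkSeries R = 1 + relMatrix R * relWalkSeries R := by
  ext i j t
  rw [Matrix.add_apply, Matrix.mul_apply, map_add, map_sum]
  cases t with
  | zero =>
    simp [relWalkSeries, relMatrix, relWalkCount_zero, Matrix.one_apply, apply_ite, ite_mul]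
  | succ t =>
    simp [relWalkSeries, relMatrix, relWalkCount_succ, Matrix.one_apply, ite_mul,
      apply_ite (PowerSeries.coeff (t + 1)), PowerSeries.coeff_succ_X_mul, PowerSeries.coeff_one]

lemma one_sub_relMatrix_mul : (1 - relMatrix R) * relWalkSeries R = 1 := by
  rw [sub_mul, one_mul, sub_eq_iff_eq_add]
  exact relWalkSeries_eq R

lemma relWalkSeries_mul_one_sub : relWalkSeries R * (1 - relMatrix R) = 1 :=
  mul_eq_one_comm.mp (one_sub_relMatrix_mul R)

/-- The resolvent identity for walk generating functions. -/
lemma relWalkSeries_sub (S : Fin n → Fin n → Prop) [DecidableRel S] :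
    relWalkSeries R - relWalkSeries S =
      relWalkSeries S * (relMatrix R - relMatrix S) * relWalkSeries R := by
  have key : relWalkSeries S * (relMatrix R - relMatrix S) * relWalkSeries R =
      relWalkSeries S * (1 - relMatrix S) * relWalkSeries R -
        relWalkSeries S * ((1 - relMatrix R) * relWalkSeries R) := by
    noncomm_ring
  rw [key, relWalkSeries_mul_one_sub, one_sub_relMatrix_mul, one_mul, mul_one]

end

/-- `G` has a link from `a` to `b`. -/
def IsLink {n : ℕ} (G : Matrix (Fin n) (Fin n) ℤ) (a b : Fin n) : Prop := G a b = 1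

instance {n : ℕ} (G : Matrix (Fin n) (Fin n) ℤ) : DecidableRel (IsLink G) :=
  fun a b => inferInstanceAs (Decidable (G a b = 1))

section

variable {n : ℕ} (G : Matrix (Fin n) (Fin n) ℤ) (L : Finset (Fin n × Fin n)) (i j : Fin n)

lemma mSer_eq_relWalkSeries : mSer G i j = relWalkSeries (IsLink G) i j := rfl

lemma mAvoidL_eq_relWalkSeries :
    mAvoidL G L i j = relWalkSeries (fun a b => IsLink G a b ∧ (a, b) ∉ L) i j := by
  simp only [mAvoidL, walkCountAvoidL, relWalkSeries, relWalkCount, Matrix.of_apply, forall_and, IsLink]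

lemma mSer_eq_mAvoidL_add_mUseL : mSer G i j = mAvoidL G L i j + mUseL G L i j := by
  ext t
  simp only [mSer, mAvoidL, mUseL, map_add, PowerSeries.coeff_mk]
  norm_cast
  unfold walkCount walkCountAvoidL walkCountUseL
  rw [← Finset.card_filter_add_card_filter_not
    (fun w : Fin (t + 1) → Fin n => ∀ k : Fin t, (w k.castSucc, w k.succ) ∉ L)]
  simp only [Finset.filter_filter, and_assoc, not_forall, not_not]

end

theorem stmt3 {n : ℕ} (hn : 0 < n) (G : Matrix (Fin n) (Fin n) ℤ)
    (hG : ∀ i j, G i j = 0 ∨ G i j = 1) (hdiag : ∀ i, G i i = 0)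
    (L : Finset (Fin n × Fin n)) (hL : ∀ p ∈ L, G p.1 p.2 = 1) (i j : Fin n) :
    mSer G i j = mAvoidL G L i j + mUseL G L i j ∧
    mUseL G L i j = ∑ p ∈ L, mAvoidL G L i p.1 * mSer G p.2 j * PowerSeries.X := by
  refine ⟨mSer_eq_mAvoidL_add_mUseL G L i j, ?_⟩
  have hsub : relMatrix (IsLink G) - relMatrix (fun a b => IsLink G a b ∧ (a, b) ∉ L) =
      relMatrix (fun a b => (a, b) ∈ L) := by
    ext1 a b
    have hab : (a, b) ∈ L → IsLink G a b := hL (a, b)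
    by_cases h : (a, b) ∈ L <;> simp [relMatrix, h, hab]
  rw [← sub_eq_of_eq_add' (mSer_eq_mAvoidL_add_mUseL G L i j), mSer_eq_relWalkSeries,
    mAvoidL_eq_relWalkSeries, ← Matrix.sub_apply, relWalkSeries_sub, hsub, Matrix.mul_apply]
  simp only [mSer_eq_relWalkSeries, mAvoidL_eq_relWalkSeries, Matrix.mul_apply, Finset.sum_mul]
  rw [Finset.sum_comm, ← Fintype.sum_prod_type', ← Finset.sum_subset (Finset.subset_univ L)]
  · refine Finset.sum_congr rfl fun p hp => ?_
    simp only [relMatrix, Matrix.of_apply, Prod.mk.eta, hp, if_true]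
    ring
  · intro p _ hp
    simp [relMatrix, hp]
end

section
/- For every subset A ⊆ N the following hold in ℤ[[x]]: (i) for all i ∉ A and j ∈ A, Σ_{l∈A} m_{il}^{¬A} · m_{lj} = m_{ij} (in matrix form, M_{A^C A}^{¬A} · M_{AA} = M_{A^C A}); (ii) for all i ∈ A and j ∉ A, Σ_{l∈A} m_{il} · m_{lj}^{¬A} = m_{ij} (in matrix form, M_{AA} · M_{A A^C}^{¬A} = M_{A A^C}). -/
lemma walkCountAvoid_empty {n : ℕ} (G : Matrix (Fin n) (Fin n) ℤ) (i j : Fin n) (t : ℕ) :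
    walkCountAvoid G ∅ i j t = walkCount G i j t := by
  simp [walkCountAvoid, walkCount]

lemma walkCountAvoid_zero {n : ℕ} (G : Matrix (Fin n) (Fin n) ℤ) (A : Finset (Fin n))
    (i j : Fin n) : walkCountAvoid G A i j 0 = if i = j then 1 else 0 := by
  unfold walkCountAvoid
  split_ifs with h
  · rw [Finset.card_eq_one]
    refine ⟨fun _ => i, ?_⟩
    ext w
    simp only [Finset.mem_filter, Finset.mem_univ, true_and, Finset.mem_singleton]
    constructor
    · rintro ⟨h0, -⟩
      funext k
      rw [Fin.fin_one_eq_zero k]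
      exact h0
    · rintro rfl
      exact ⟨rfl, h, fun k => k.elim0, fun k hk => absurd (Fin.fin_one_eq_zero k) hk⟩
  · rw [Finset.card_eq_zero, Finset.filter_eq_empty_iff]
    rintro w - ⟨h0, h1, -⟩
    exact h (h0.symm.trans h1)

/-- Splitting a walk at its first step. -/
lemma walkCountAvoid_succ {n : ℕ} (G : Matrix (Fin n) (Fin n) ℤ) (A : Finset (Fin n))
    (i j : Fin n) (t : ℕ) :
    walkCountAvoid G A i j (t + 1) =
      ∑ k, if G i k = 1 ∧ (t = 0 ∨ k ∉ A) then walkCountAvoid G A k j t else 0 := by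
  unfold walkCountAvoid
  rw [Finset.card_eq_sum_card_fiberwise (f := fun w => w 1) (t := Finset.univ)
    (fun _ _ => Finset.mem_coe.2 (Finset.mem_univ _))]
  refine Finset.sum_congr rfl fun k _ => ?_
  have avoid_iff (w : Fin (t + 1 + 1) → Fin n) :
      (∀ m, m ≠ 0 → m ≠ Fin.last (t + 1) → w m ∉ A) ↔
        (t = 0 ∨ Fin.tail w 0 ∉ A) ∧
          ∀ m, m ≠ 0 → m ≠ Fin.last t → Fin.tail w m ∉ A := by
    rw [Fin.forall_fin_succ]
    simp only [ne_eq, not_true_eq_false, false_imp_iff, true_and, Fin.succ_ne_zero,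
      not_false_eq_true, true_imp_iff, ← Fin.succ_last, Fin.succ_inj, Fin.tail]
    constructor
    · refine fun h => ⟨?_, fun m _ => h m⟩
      by_cases ht : t = 0
      · exact Or.inl ht
      · exact Or.inr (h 0 fun h0 => ht (by simpa [Fin.ext_iff] using h0.symm))
    · rintro ⟨h0, h⟩ m hm
      by_cases hm0 : m = 0
      · subst hm0
        refine h0.resolve_left fun ht => hm ?_
        subst ht
        rfl
      · exact h m hm0 hm
  have walk_iff (w : Fin (t + 1 + 1) → Fin n) :
      (∀ m : Fin (t + 1), G (w m.castSucc) (w m.succ) = 1) ↔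
        G (w 0) (w 1) = 1 ∧
          ∀ m : Fin t, G (Fin.tail w m.castSucc) (Fin.tail w m.succ) = 1 := by
    rw [Fin.forall_fin_succ]
    rfl
  split_ifs with h
  · refine Finset.card_nbij' Fin.tail (fun v => Fin.cons i v) ?_ ?_ ?_ ?_
    · intro w hw
      simp only [Finset.coe_filter, Finset.mem_filter, Finset.mem_univ, true_and,
        Set.mem_ofPred_eq, avoid_iff, walk_iff] at hw ⊢
      exact ⟨hw.2, hw.1.2.1, hw.1.2.2.1.2, hw.1.2.2.2.2⟩
    · intro v hv
      simp only [Finset.coe_filter, Finset.mem_filter, Finset.mem_univ, true_and,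
        Set.mem_ofPred_eq, avoid_iff, walk_iff, Fin.tail_cons] at hv ⊢
      obtain ⟨rfl, hj, hw, ha⟩ := hv
      exact ⟨⟨rfl, hj, ⟨h.1, hw⟩, h.2, ha⟩, rfl⟩
    · intro w hw
      simp only [Finset.coe_filter, Finset.mem_filter, Finset.mem_univ, true_and,
        Set.mem_ofPred_eq] at hw
      rw [← hw.1.1]
      exact Fin.cons_self_tail w
    · intro v _
      exact Fin.tail_cons _ _
  · rw [Finset.card_eq_zero, Finset.filter_eq_empty_iff]
    intro w hw hk
    simp only [Finset.mem_filter, Finset.mem_univ, true_and, avoid_iff, walk_iff] at hw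
    obtain ⟨rfl, -, hw, ha⟩ := hw
    subst hk
    exact h ⟨hw.1, ha.1⟩

/-- Reversing walks. -/
lemma walkCountAvoid_transpose {n : ℕ} (G : Matrix (Fin n) (Fin n) ℤ) (A : Finset (Fin n))
    (i j : Fin n) (t : ℕ) :
    walkCountAvoid G.transpose A j i t = walkCountAvoid G A i j t := by
  have reverse (H : Matrix (Fin n) (Fin n) ℤ) (a b : Fin n) (w : Fin (t + 1) → Fin n)
      (hw : w 0 = a ∧ w (Fin.last t) = b ∧
        (∀ k : Fin t, H (w k.castSucc) (w k.succ) = 1) ∧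
        ∀ k : Fin (t + 1), k ≠ 0 → k ≠ Fin.last t → w k ∉ A) :
      w (Fin.rev 0) = b ∧ w (Fin.rev (Fin.last t)) = a ∧
        (∀ k : Fin t, H.transpose (w k.castSucc.rev) (w k.succ.rev) = 1) ∧
        ∀ k : Fin (t + 1), k ≠ 0 → k ≠ Fin.last t → w k.rev ∉ A := by
    obtain ⟨h0, h1, hs, ha⟩ := hw
    refine ⟨by rwa [Fin.rev_zero], by rwa [Fin.rev_last], fun k => ?_, fun k hk hk' => ?_⟩
    · rw [Fin.rev_castSucc, Fin.rev_succ]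
      exact hs k.rev
    · refine ha _ (fun h => hk' ?_) (fun h => hk ?_)
      · rw [← Fin.rev_rev k, h, Fin.rev_zero]
      · rw [← Fin.rev_rev k, h, Fin.rev_last]
  unfold walkCountAvoid
  refine Finset.card_nbij' (fun w => w ∘ Fin.rev) (fun w => w ∘ Fin.rev) ?_ ?_ ?_ ?_
  · intro w hw
    simp only [Finset.coe_filter, Finset.mem_univ, true_and, Set.mem_ofPred_eq] at hw ⊢
    exact reverse _ _ _ w hw
  · intro w hw
    simp only [Finset.coe_filter, Finset.mem_univ, true_and, Set.mem_ofPred_eq] at hw ⊢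
    exact reverse _ _ _ w hw
  · intro w _
    funext k
    simp
  · intro w _
    funext k
    simp

lemma mAvoid_empty {n : ℕ} (G : Matrix (Fin n) (Fin n) ℤ) (i j : Fin n) :
    mAvoid G ∅ i j = mSer G i j := by
  simp only [mAvoid, mSer, walkCountAvoid_empty]

lemma mAvoid_transpose {n : ℕ} (G : Matrix (Fin n) (Fin n) ℤ) (A : Finset (Fin n))
    (i j : Fin n) : mAvoid G.transpose A j i = mAvoid G A i j := by
  simp only [mAvoid, walkCountAvoid_transpose]

lemma mSer_transpose {n : ℕ} (G : Matrix (Fin n) (Fin n) ℤ) (i j : Fin n) :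
    mSer G.transpose j i = mSer G i j := by
  simp only [← mAvoid_empty, mAvoid_transpose]

/-- First-step recursion for the series counting walks that avoid `A`. -/
lemma mAvoid_eq {n : ℕ} (G : Matrix (Fin n) (Fin n) ℤ) (A : Finset (Fin n)) (i j : Fin n) :
    mAvoid G A i j = (if i = j then 1 else 0) +
      PowerSeries.X * ∑ k, if G i k = 1 then
        (if k ∈ A then (if k = j then 1 else 0) else mAvoid G A k j) else 0 := by
  ext t
  cases t with
  | zero =>
    simp only [mAvoid, PowerSeries.coeff_mk, walkCountAvoid_zero, map_add,
      PowerSeries.coeff_zero_X_mul, add_zero]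
    split_ifs <;> simp
  | succ t =>
    simp only [map_add, PowerSeries.coeff_succ_X_mul, map_sum]
    have h : PowerSeries.coeff (t + 1) (if i = j then (1 : PowerSeries ℤ) else 0) = 0 := by
      split_ifs <;> simp [PowerSeries.coeff_one]
    rw [h, zero_add, mAvoid, PowerSeries.coeff_mk, walkCountAvoid_succ, Nat.cast_sum]
    refine Finset.sum_congr rfl fun k _ => ?_
    by_cases hk : G i k = 1 <;> by_cases hA : k ∈ A <;> by_cases ht : t = 0 <;>
      by_cases hj : k = j <;> try subst hj
    all_goals simp [*, mAvoid, walkCountAvoid_zero, PowerSeries.coeff_one]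

lemma mSer_eq {n : ℕ} (G : Matrix (Fin n) (Fin n) ℤ) (i j : Fin n) :
    mSer G i j = (if i = j then 1 else 0) +
      PowerSeries.X * ∑ k, if G i k = 1 then mSer G k j else 0 := by
  simpa [mAvoid_empty] using mAvoid_eq G ∅ i j

/-- Splitting a walk at its first visit to `A`. -/
lemma sum_mAvoid_mul_mSer {n : ℕ} (G : Matrix (Fin n) (Fin n) ℤ) (A : Finset (Fin n))
    {i j : Fin n} (hi : i ∉ A) (hj : j ∈ A) :
    ∑ l ∈ A, mAvoid G A i l * mSer G l j = mSer G i j := by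
  have step (i : Fin n) (hi : i ∉ A) :
      ∑ l ∈ A, mAvoid G A i l * mSer G l j =
        PowerSeries.X * ∑ k, if G i k = 1 then
          (if k ∈ A then mSer G k j else ∑ l ∈ A, mAvoid G A k l * mSer G l j) else 0 := by
    have hl (l : Fin n) (hl : l ∈ A) : mAvoid G A i l * mSer G l j =
        PowerSeries.X * ∑ k, (if G i k = 1 then
          (if k ∈ A then (if k = l then 1 else 0) else mAvoid G A k l) else 0) *
            mSer G l j := by
      rw [mAvoid_eq, if_neg (ne_of_mem_of_not_mem hl hi).symm, zero_add, mul_assoc, Finset.sum_mul]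
    rw [Finset.sum_congr rfl hl, ← Finset.mul_sum, Finset.sum_comm]
    congr 1
    refine Finset.sum_congr rfl fun k _ => ?_
    by_cases hk : G i k = 1 <;> by_cases hA : k ∈ A <;> simp [hk, hA, ite_mul]
  ext t
  induction t generalizing i with
  | zero =>
    rw [step i hi, mSer_eq, if_neg (ne_of_mem_of_not_mem hj hi).symm, zero_add,
      PowerSeries.coeff_zero_X_mul, PowerSeries.coeff_zero_X_mul]
  | succ t ih =>
    rw [step i hi, mSer_eq, if_neg (ne_of_mem_of_not_mem hj hi).symm, zero_add,
      PowerSeries.coeff_succ_X_mul, PowerSeries.coeff_succ_X_mul, map_sum, map_sum]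
    refine Finset.sum_congr rfl fun k _ => ?_
    split_ifs with hk hA
    · rfl
    · exact ih hA
    · rfl


/-- (i) `M_{A^C A}^{¬A} · M_{AA} = M_{A^C A}` and (ii) `M_{AA} · M_{A A^C}^{¬A} = M_{A A^C}`,
stated entrywise. -/
theorem stmt4 {n : ℕ} (hn : 0 < n) (G : Matrix (Fin n) (Fin n) ℤ)
    (hG : ∀ i j, G i j = 0 ∨ G i j = 1) (hdiag : ∀ i, G i i = 0)
    (A : Finset (Fin n)) :
    (∀ i ∉ A, ∀ j ∈ A, ∑ l ∈ A, mAvoid G A i l * mSer G l j = mSer G i j) ∧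
    (∀ i ∈ A, ∀ j ∉ A, ∑ l ∈ A, mSer G i l * mAvoid G A l j = mSer G i j) := by
  refine ⟨fun i hi j hj => sum_mAvoid_mul_mSer G A hi hj, fun i hi j hj => ?_⟩
  rw [← mSer_transpose, ← sum_mAvoid_mul_mSer G.transpose A hj hi]
  refine Finset.sum_congr rfl fun l _ => ?_
  rw [mAvoid_transpose, mSer_transpose, mul_comm]
end

section
/- Let L be a set of links of G and let L also denote the N×N matrix with (l,k)-entry 1 if (l,k)∈L and 0 otherwise. Then over the matrices with entries in ℤ[[x]], both I + x·L·M and I − x·M^{¬L}·L are invertible, and M^{¬L} = M·(I + x·L·M)^{-1} and M = (I − x·M^{¬L}·L)^{-1}·M^{¬L}. -/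
/-- The full walk generating matrix `M`. -/
noncomputable def Mfull {n : ℕ} (G : Matrix (Fin n) (Fin n) ℤ) :
    Matrix (Fin n) (Fin n) (PowerSeries ℤ) :=
  Matrix.of fun i j => mSer G i j

/-- The matrix `M^{¬L}` of `L`-avoiding walk generating functions. -/
noncomputable def MfullAvoidL {n : ℕ} (G : Matrix (Fin n) (Fin n) ℤ)
    (L : Finset (Fin n × Fin n)) : Matrix (Fin n) (Fin n) (PowerSeries ℤ) :=
  Matrix.of fun i j => mAvoidL G L i j

/-- The 0-1 matrix of the link set `L`, over `ℤ[[x]]`. -/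
noncomputable def linkMat {n : ℕ} (L : Finset (Fin n × Fin n)) :
    Matrix (Fin n) (Fin n) (PowerSeries ℤ) :=
  Matrix.of fun a b => if (a, b) ∈ L then 1 else 0

/-- The number of length-`t` walks from `i` to `j` along links in `E`. -/
def linkWalkCount {n : ℕ} (E : Finset (Fin n × Fin n)) (i j : Fin n) (t : ℕ) : ℕ :=
  (Finset.univ.filter fun w : Fin (t + 1) → Fin n =>
    w 0 = i ∧ w (Fin.last t) = j ∧ ∀ k : Fin t, (w k.castSucc, w k.succ) ∈ E).card

/-- The generating matrix of walks along links in `E`. -/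
noncomputable def linkWalkMat {n : ℕ} (E : Finset (Fin n × Fin n)) :
    Matrix (Fin n) (Fin n) (PowerSeries ℤ) :=
  Matrix.of fun i j => PowerSeries.mk fun t => (linkWalkCount E i j t : ℤ)

lemma linkWalkCount_zero {n : ℕ} (E : Finset (Fin n × Fin n)) (i j : Fin n) :
    linkWalkCount E i j 0 = if i = j then 1 else 0 := by
  unfold linkWalkCount
  split_ifs with h
  · subst h
    rw [Finset.card_eq_one]
    refine ⟨fun _ => i, ?_⟩
    ext w
    simp only [Finset.mem_filter, Finset.mem_univ, true_and, Finset.mem_singleton]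
    constructor
    · rintro ⟨h0, -⟩
      funext k
      rw [Subsingleton.elim (α := Fin 1) k 0, h0]
    · rintro rfl
      exact ⟨rfl, rfl, fun k => k.elim0⟩
  · rw [Finset.card_eq_zero, Finset.filter_eq_empty_iff]
    rintro w - ⟨h0, h1, -⟩
    exact h (h0.symm.trans h1)

lemma linkWalkCount_succ {n : ℕ} (E : Finset (Fin n × Fin n)) (i j : Fin n)
    (t : ℕ) :
    linkWalkCount E i j (t + 1) = ∑ k, if (i, k) ∈ E then linkWalkCount E k j t else 0 := by
  have key : linkWalkCount E i j (t + 1) =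
      (Finset.univ.filter fun w : Fin (t + 1) → Fin n => (i, w 0) ∈ E ∧
        w (Fin.last t) = j ∧ ∀ k : Fin t, (w k.castSucc, w k.succ) ∈ E).card := by
    unfold linkWalkCount
    refine Finset.card_bij' (fun w _ => Fin.tail w) (fun w _ => Fin.cons i w) ?_ ?_ ?_ ?_
    · intro w hw
      simp only [Finset.mem_filter, Finset.mem_univ, true_and, Fin.forall_fin_succ (n := t)] at hw ⊢
      obtain ⟨rfl, hj, h0, hs⟩ := hw
      exact ⟨h0, hj, hs⟩
    · intro w hw
      simp only [Finset.mem_filter, Finset.mem_univ, true_and, Fin.forall_fin_succ (n := t)] at hw ⊢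
      exact ⟨rfl, hw.2.1, hw.1, hw.2.2⟩
    · intro w hw
      simp only [Finset.mem_filter, Finset.mem_univ, true_and] at hw
      rw [← hw.1, Fin.cons_self_tail]
    · intro w _
      exact Fin.tail_cons _ _
  rw [key, Finset.card_eq_sum_card_fiberwise (f := fun w => w 0) (t := Finset.univ)
    (fun _ _ => Finset.mem_coe.2 (Finset.mem_univ _))]
  refine Finset.sum_congr rfl fun k _ => ?_
  rw [Finset.filter_filter]
  split_ifs with h
  · unfold linkWalkCount
    congr 1
    ext w
    simp only [Finset.mem_filter, Finset.mem_univ, true_and]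
    constructor
    · rintro ⟨⟨-, hj, hs⟩, h0⟩
      exact ⟨h0, hj, hs⟩
    · rintro ⟨rfl, hj, hs⟩
      exact ⟨⟨h, hj, hs⟩, rfl⟩
  · rw [Finset.card_eq_zero, Finset.filter_eq_empty_iff]
    rintro w - ⟨⟨hR, -⟩, rfl⟩
    exact h hR

lemma linkWalkMat_eq {n : ℕ} (E : Finset (Fin n × Fin n)) :
    linkWalkMat E = 1 + (PowerSeries.X : PowerSeries ℤ) • (linkMat E * linkWalkMat E) := by
  ext i j t
  rw [Matrix.add_apply, Matrix.smul_apply, Matrix.mul_apply, smul_eq_mul, map_add]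
  cases t with
  | zero =>
    simp [linkWalkMat, linkWalkCount_zero, Matrix.one_apply, apply_ite]
  | succ t =>
    have hone : PowerSeries.coeff (t + 1) ((1 : Matrix (Fin n) (Fin n) (PowerSeries ℤ)) i j) = 0 := by
      rw [Matrix.one_apply]
      split_ifs <;> simp [PowerSeries.coeff_one]
    rw [hone, zero_add, PowerSeries.coeff_succ_X_mul, map_sum]
    simp [linkWalkMat, linkMat, linkWalkCount_succ, ite_mul, apply_ite]

lemma one_sub_linkMat_mul_linkWalkMat {n : ℕ} (E : Finset (Fin n × Fin n)) :
    (1 - (PowerSeries.X : PowerSeries ℤ) • linkMat E) * linkWalkMat E = 1 := by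
  rw [sub_mul, one_mul, Matrix.smul_mul, sub_eq_iff_eq_add]
  exact linkWalkMat_eq E

/-- The links of the graph with 0-1 adjacency matrix `G`. -/
def links {n : ℕ} (G : Matrix (Fin n) (Fin n) ℤ) : Finset (Fin n × Fin n) :=
  Finset.univ.filter fun p => G p.1 p.2 = 1

lemma Mfull_eq_linkWalkMat {n : ℕ} (G : Matrix (Fin n) (Fin n) ℤ) :
    Mfull G = linkWalkMat (links G) := by
  simp [Mfull, mSer, walkCount, linkWalkMat, linkWalkCount, links]

lemma MfullAvoidL_eq_linkWalkMat {n : ℕ} (G : Matrix (Fin n) (Fin n) ℤ)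
    (L : Finset (Fin n × Fin n)) :
    MfullAvoidL G L = linkWalkMat (links G \ L) := by
  simp [MfullAvoidL, mAvoidL, walkCountAvoidL, linkWalkMat, linkWalkCount, links, forall_and]

lemma linkMat_sdiff_add_linkMat {n : ℕ} {E L : Finset (Fin n × Fin n)} (h : L ⊆ E) :
    linkMat (E \ L) + linkMat L = linkMat E := by
  refine Matrix.ext fun i j => ?_
  by_cases hij : (i, j) ∈ L
  · simp [linkMat, hij, h hij]
  · simp [linkMat, hij]

/-- Resolvent identities for `M = (1 - x (B + K))⁻¹` and `N = (1 - x B)⁻¹`. -/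
lemma Matrix.resolvent_perturbation {ι R : Type*} [Fintype ι] [DecidableEq ι] [CommRing R] (x : R)
    {B K M N : Matrix ι ι R} (hM : (1 - x • (B + K)) * M = 1) (hN : (1 - x • B) * N = 1) :
    IsUnit (1 + x • (K * M)) ∧ IsUnit (1 - x • (N * K)) ∧
      N = M * (1 + x • (K * M))⁻¹ ∧ M = (1 - x • (N * K))⁻¹ * N := by
  have hM_comm := mul_eq_one_comm.1 hM
  have hN_comm := mul_eq_one_comm.1 hN
  have hleft : 1 + x • (K * M) = (1 - x • B) * M := by
    have h : (1 - x • B) * M = (1 - x • (B + K)) * M + x • (K * M) := by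
      rw [← Matrix.smul_mul, ← add_mul, smul_add, ← sub_sub, sub_add_cancel]
    rw [h, hM]
  have hright : 1 - x • (N * K) = N * (1 - x • (B + K)) := by
    rw [smul_add, ← sub_sub, mul_sub, hN_comm, Matrix.mul_smul]
  rw [hleft, hright]
  refine ⟨(IsUnit.of_mul_eq_one _ hN).mul (.of_mul_eq_one _ hM_comm),
    (IsUnit.of_mul_eq_one _ hN_comm).mul (.of_mul_eq_one _ hM), ?_, ?_⟩
  · rw [Matrix.mul_inv_rev, Matrix.inv_eq_right_inv hN, Matrix.inv_eq_right_inv hM_comm,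
      ← mul_assoc, hM_comm, one_mul]
  · rw [Matrix.mul_inv_rev, Matrix.inv_eq_right_inv hM, Matrix.inv_eq_right_inv hN_comm,
      mul_assoc, hN, mul_one]

theorem stmt8 {n : ℕ} (hn : 0 < n) (G : Matrix (Fin n) (Fin n) ℤ)
    (hG : ∀ i j, G i j = 0 ∨ G i j = 1) (hdiag : ∀ i, G i i = 0)
    (L : Finset (Fin n × Fin n)) (hL : ∀ p ∈ L, G p.1 p.2 = 1) :
    IsUnit (1 + (PowerSeries.X : PowerSeries ℤ) • (linkMat L * Mfull G)) ∧
    IsUnit (1 - (PowerSeries.X : PowerSeries ℤ) • (MfullAvoidL G L * linkMat L)) ∧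
    MfullAvoidL G L =
      Mfull G * (1 + (PowerSeries.X : PowerSeries ℤ) • (linkMat L * Mfull G))⁻¹ ∧
    Mfull G =
      (1 - (PowerSeries.X : PowerSeries ℤ) • (MfullAvoidL G L * linkMat L))⁻¹ *
        MfullAvoidL G L := by
  have hsub : L ⊆ links G := fun p hp => by simp [links, hL p hp]
  rw [Mfull_eq_linkWalkMat, MfullAvoidL_eq_linkWalkMat]
  refine Matrix.resolvent_perturbation _ ?_ (one_sub_linkMat_mul_linkWalkMat _)
  rw [linkMat_sdiff_add_linkMat hsub]
  exact one_sub_linkMat_mul_linkWalkMat _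
end
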